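/- arXiv:1105.2611 — 10 statements merged into one kernel-verified Lean document; each statement's English description precedes it below -/
import Mathlib

section
/- Let f : ℝ → ℝ be infinitely differentiable, let a > 0, and let k ≥ 2 be a natural number. Suppose the sequence of functions f_{k,n}(t) := ((-1)^n / n!) · t^n · f^{(n+k)}(t) converges uniformly on (-a, a) as n → ∞ (to some limit function). Then the series \hat{f}(t) converges uniformly on (-a, a) to the constant f(0); in particular \hat{f}(t) = f(0) for every t ∈ (-a, a). -/
open Filter Finset

/-- The function `t ↦ ((-1)^n / n!) t^n f^{(n+k)}(t)`. -/
noncomputable def taylorTerm (f : ℝ → ℝ) (k n : ℕ) (t : ℝ) : ℝ :=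
  ((-1 : ℝ) ^ n / (n.factorial : ℝ)) * t ^ n * iteratedDeriv (n + k) f t

theorem taylorTerm_succ (f : ℝ → ℝ) (k n : ℕ) (t : ℝ) :
    taylorTerm f k (n + 1) t = -(t / (n + 1)) * taylorTerm f (k + 1) n t := by
  have hn : (n.factorial : ℝ) ≠ 0 := by positivity
  have hn' : (n + 1 : ℝ) ≠ 0 := by positivity
  simp only [taylorTerm, show n + 1 + k = n + (k + 1) by ring, Nat.factorial_succ]
  push_cast
  field_simp
  ring

theorem continuous_taylorTerm {f : ℝ → ℝ} (hf : ContDiff ℝ (⊤ : ℕ∞) f) (k n : ℕ) :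
    Continuous (taylorTerm f k n) := by
  have := hf.continuous_iteratedDeriv (n + k) (mod_cast le_top)
  unfold taylorTerm
  fun_prop

/-- A uniform bound on the terms of order `k + 1` forces those of order `k` to tend to zero. -/
theorem eventually_abs_taylorTerm_le {f : ℝ → ℝ} {a M : ℝ} {k : ℕ}
    (h : ∀ᶠ n in atTop, ∀ t ∈ Set.Ioo (-a) a, |taylorTerm f (k + 1) n t| ≤ M)
    {ε : ℝ} (hε : 0 < ε) :
    ∀ᶠ n in atTop, ∀ t ∈ Set.Ioo (-a) a, |taylorTerm f k n t| ≤ ε := by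
  have hlim : Tendsto (fun n : ℕ => a * M * (1 / ((n : ℝ) + 1))) atTop (nhds 0) := by
    simpa using tendsto_one_div_add_atTop_nhds_zero_nat.const_mul (a * M)
  rw [← map_add_atTop_eq_nat 1, eventually_map]
  filter_upwards [h, hlim.eventually_le_const hε] with n hn hle t ht
  have hta : |t| ≤ a := (abs_lt.2 ht).le
  have hpos : (0 : ℝ) < n + 1 := by positivity
  calc |taylorTerm f k (n + 1) t| = |t| / (n + 1) * |taylorTerm f (k + 1) n t| := by
        rw [taylorTerm_succ, abs_mul, abs_neg, abs_div, abs_of_pos hpos]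
    _ ≤ a / (n + 1) * M := by
        gcongr
        · exact div_nonneg ((abs_nonneg t).trans hta) hpos.le
        · exact hn t ht
    _ = a * M * (1 / ((n : ℝ) + 1)) := by ring
    _ ≤ ε := hle

theorem exists_eventually_abs_taylorTerm_le_of_le {f : ℝ → ℝ} {a : ℝ} {j k : ℕ} (hjk : j ≤ k)
    (h : ∃ M, ∀ᶠ n in atTop, ∀ t ∈ Set.Ioo (-a) a, |taylorTerm f k n t| ≤ M) :
    ∃ M, ∀ᶠ n in atTop, ∀ t ∈ Set.Ioo (-a) a, |taylorTerm f j n t| ≤ M := by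
  induction k, hjk using Nat.le_induction with
  | base => exact h
  | succ k _ ih =>
    obtain ⟨M, hM⟩ := h
    exact ih ⟨1, eventually_abs_taylorTerm_le hM one_pos⟩

/-- A uniformly convergent sequence of terms is eventually uniformly bounded. -/
theorem exists_eventually_abs_taylorTerm_le {f g : ℝ → ℝ} (hf : ContDiff ℝ (⊤ : ℕ∞) f)
    {a : ℝ} {k : ℕ} (h : TendstoUniformlyOn (taylorTerm f k) g atTop (Set.Ioo (-a) a)) :
    ∃ M, ∀ᶠ n in atTop, ∀ t ∈ Set.Ioo (-a) a, |taylorTerm f k n t| ≤ M := by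
  have h1 := Metric.tendstoUniformlyOn_iff.1 h 1 one_pos
  obtain ⟨m, hm⟩ := h1.exists
  obtain ⟨C, hC⟩ := isCompact_Icc.exists_bound_of_continuousOn
    (s := Set.Icc (-a) a) (continuous_taylorTerm hf k m).continuousOn
  refine ⟨C + 2, h1.mono fun n hn t ht => ?_⟩
  have hnt := hn t ht
  have hmt := hm t ht
  have hCt := hC t (Set.Ioo_subset_Icc_self ht)
  rw [Real.dist_eq, abs_lt] at hnt hmt
  rw [Real.norm_eq_abs, abs_le] at hCt
  rw [abs_le]
  constructor <;> linarith

/-- The derivatives of the partial sums telescope. -/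
theorem hasDerivAt_sum_taylorTerm {f : ℝ → ℝ} (hf : ContDiff ℝ (⊤ : ℕ∞) f) (N : ℕ) (t : ℝ) :
    HasDerivAt (fun t => ∑ n ∈ Finset.range (N + 1), taylorTerm f 0 n t)
      (taylorTerm f 1 N t) t := by
  have hderiv (n : ℕ) : HasDerivAt (iteratedDeriv n f) (iteratedDeriv (n + 1) f t) t := by
    rw [iteratedDeriv_succ]
    exact (hf.differentiable_iteratedDeriv n (mod_cast WithTop.coe_lt_top n) t).hasDerivAt
  induction N with
  | zero => simpa [taylorTerm] using hderiv 0
  | succ N ih =>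
    simp only [Finset.sum_range_succ _ (N + 1)]
    have hterm : HasDerivAt (taylorTerm f 0 (N + 1))
        (((-1 : ℝ) ^ (N + 1) / ((N + 1).factorial : ℝ)) * ((N + 1 : ℕ) * t ^ N) *
            iteratedDeriv (N + 1) f t +
          ((-1 : ℝ) ^ (N + 1) / ((N + 1).factorial : ℝ)) * t ^ (N + 1) *
            iteratedDeriv (N + 1 + 1) f t) t :=
      ((hasDerivAt_pow (N + 1) t).const_mul _).mul (hderiv (N + 1))
    refine (ih.add hterm).congr_deriv ?_
    have hN : (N.factorial : ℝ) ≠ 0 := by positivity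
    have hN' : (N + 1 : ℝ) ≠ 0 := by positivity
    simp only [taylorTerm, Nat.factorial_succ]
    push_cast
    field_simp
    ring

theorem sum_taylorTerm_zero (f : ℝ → ℝ) (N : ℕ) :
    ∑ n ∈ Finset.range (N + 1), taylorTerm f 0 n 0 = f 0 := by
  simp [Finset.sum_range_succ', taylorTerm]

/-- If for some `k ≥ 2` the functions `f_{k,n}(t) = ((-1)^n/n!) t^n f^{(n+k)}(t)` converge
uniformly on `(-a, a)` as `n → ∞` (to some limit `g`), then the series
`∑_{n=0}^∞ ((-1)^n/n!) t^n f^{(n)}(t)` converges uniformly on `(-a, a)` to the constant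
`f(0)`; in particular it converges pointwise to `f(0)` there. -/
theorem stmt1 (f : ℝ → ℝ) (hf : ContDiff ℝ (⊤ : ℕ∞) f) (a : ℝ) (ha : 0 < a)
    (k : ℕ) (hk : 2 ≤ k) (g : ℝ → ℝ)
    (hunif : TendstoUniformlyOn
      (fun (n : ℕ) (t : ℝ) =>
        ((-1 : ℝ) ^ n / (n.factorial : ℝ)) * t ^ n * iteratedDeriv (n + k) f t)
      g atTop (Set.Ioo (-a) a)) :
    TendstoUniformlyOn
      (fun (N : ℕ) (t : ℝ) => ∑ n ∈ Finset.range N,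
        ((-1 : ℝ) ^ n / (n.factorial : ℝ)) * t ^ n * iteratedDeriv n f t)
      (fun _ => f 0) atTop (Set.Ioo (-a) a) ∧
    ∀ t ∈ Set.Ioo (-a) a,
      Filter.Tendsto
        (fun N : ℕ => ∑ n ∈ Finset.range N,
          ((-1 : ℝ) ^ n / (n.factorial : ℝ)) * t ^ n * iteratedDeriv n f t)
        atTop (nhds (f 0)) := by
  have key : TendstoUniformlyOn
      (fun (N : ℕ) (t : ℝ) => ∑ n ∈ Finset.range N, taylorTerm f 0 n t)
      (fun _ => f 0) atTop (Set.Ioo (-a) a) := by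
    obtain ⟨M, hM⟩ := exists_eventually_abs_taylorTerm_le_of_le hk
      (exists_eventually_abs_taylorTerm_le hf hunif)
    refine Metric.tendstoUniformlyOn_iff.2 fun ε hε => ?_
    rw [← map_add_atTop_eq_nat 1, eventually_map]
    filter_upwards [eventually_abs_taylorTerm_le hM (show 0 < ε / (2 * a) by positivity)]
      with N hN t ht
    have hmvt := (convex_Ioo (-a) a).norm_image_sub_le_of_norm_hasDerivWithin_le
      (fun x _ => (hasDerivAt_sum_taylorTerm hf N x).hasDerivWithinAt) hN
      (show (0 : ℝ) ∈ Set.Ioo (-a) a from ⟨by linarith, ha⟩) ht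
    rw [sum_taylorTerm_zero, sub_zero, Real.norm_eq_abs, Real.norm_eq_abs] at hmvt
    rw [dist_comm, Real.dist_eq]
    calc _ ≤ ε / (2 * a) * |t| := hmvt
      _ ≤ ε / (2 * a) * a := by gcongr; exact (abs_lt.2 ht).le
      _ = ε / 2 := by field_simp
      _ < ε := half_lt_self hε
  exact ⟨key, fun t ht => key.tendsto_at ht⟩
end

section
/- Let f : ℝ → ℝ be infinitely differentiable and let a > 0. Suppose the sequence of functions f_{1,n}(t) := ((-1)^n / n!) · t^n · f^{(n+1)}(t) converges uniformly on (-a, a) to a function \check{f}. Then the series \hat{f}(t) converges uniformly on (-a, a), its sum is differentiable on (-a, a), and d/dt \hat{f}(t) = \check{f}(t) for all t ∈ (-a, a). In particular, if \check{f}(t) = 0 for all t ∈ (-a, a), then \hat{f}(t) = f(0) for all t ∈ (-a, a). -/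
open Filter Finset

/-- The derivative of the partial sum of `∑ ((-1)^n/n!) t^n f^{(n)}(t)` telescopes. -/
theorem hasDerivAt_sum_range_succ_pow_mul_iteratedDeriv {f : ℝ → ℝ}
    (hf : ContDiff ℝ (⊤ : ℕ∞) f) (N : ℕ) (t : ℝ) :
    HasDerivAt (fun t : ℝ => ∑ n ∈ Finset.range (N + 1),
        ((-1 : ℝ) ^ n / (n.factorial : ℝ)) * t ^ n * iteratedDeriv n f t)
      (((-1 : ℝ) ^ N / (N.factorial : ℝ)) * t ^ N * iteratedDeriv (N + 1) f t) t := by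
  have hD (n : ℕ) : HasDerivAt (iteratedDeriv n f) (iteratedDeriv (n + 1) f t) t := by
    rw [iteratedDeriv_succ]
    exact (hf.differentiable_iteratedDeriv n
      (by exact_mod_cast ENat.natCast_lt_top n)).differentiableAt.hasDerivAt
  induction N with
  | zero => simpa using hD 0
  | succ N ih =>
    simp_rw [Finset.sum_range_succ _ (N + 1)]
    refine (ih.fun_add
      (((hasDerivAt_pow (N + 1) t).const_mul _).fun_mul (hD (N + 1)))).congr_deriv ?_
    have h : ((N.factorial : ℝ)) ≠ 0 := by positivity
    have h1 : ((N : ℝ) + 1) ≠ 0 := by positivity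
    rw [Nat.factorial_succ]
    push_cast
    field_simp
    ring

/-- If `f_{1,n}(t) = ((-1)^n/n!) t^n f^{(n+1)}(t)` converges uniformly on `(-a, a)` to a
function `fcheck`, then the series `∑_{n=0}^∞ ((-1)^n/n!) t^n f^{(n)}(t)` converges
uniformly on `(-a, a)` to a function `S` which is differentiable on `(-a, a)` with
`S' = fcheck` there; and if `fcheck` vanishes on `(-a, a)` then `S = f(0)` on `(-a, a)`. -/
theorem stmt2 (f fcheck : ℝ → ℝ) (hf : ContDiff ℝ (⊤ : ℕ∞) f) (a : ℝ) (ha : 0 < a)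
    (hunif : TendstoUniformlyOn
      (fun (n : ℕ) (t : ℝ) =>
        ((-1 : ℝ) ^ n / (n.factorial : ℝ)) * t ^ n * iteratedDeriv (n + 1) f t)
      fcheck atTop (Set.Ioo (-a) a)) :
    ∃ S : ℝ → ℝ,
      TendstoUniformlyOn
        (fun (N : ℕ) (t : ℝ) => ∑ n ∈ Finset.range N,
          ((-1 : ℝ) ^ n / (n.factorial : ℝ)) * t ^ n * iteratedDeriv n f t)
        S atTop (Set.Ioo (-a) a) ∧
      (∀ t ∈ Set.Ioo (-a) a, HasDerivAt S (fcheck t) t) ∧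
      ((∀ t ∈ Set.Ioo (-a) a, fcheck t = 0) → ∀ t ∈ Set.Ioo (-a) a, S t = f 0) := by
  set s : Set ℝ := Set.Ioo (-a) a with hs
  let F : ℕ → ℝ → ℝ := fun N t => ∑ n ∈ Finset.range N,
    ((-1 : ℝ) ^ n / (n.factorial : ℝ)) * t ^ n * iteratedDeriv n f t
  have hball : s = Metric.ball 0 a := by simp [hs, Real.ball_eq_Ioo]
  have h0 : (0 : ℝ) ∈ s := ⟨by linarith, ha⟩
  have hF0 (N : ℕ) : F (N + 1) 0 = f 0 := by simp [F, Finset.sum_range_succ']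
  have hderiv := hasDerivAt_sum_range_succ_pow_mul_iteratedDeriv hf
  have hcauchy : UniformCauchySeqOn (fun N => F (N + 1)) atTop s := by
    have hc := hunif.uniformCauchySeqOn
    rw [hball] at hc ⊢
    refine uniformCauchySeqOn_ball_of_deriv hc (fun N t _ => hderiv N t) ?_
    simp_rw [hF0]
    exact tendsto_const_nhds.cauchy_map
  obtain ⟨S, hlim⟩ : ∃ S : ℝ → ℝ, ∀ t ∈ s, Tendsto (fun N => F (N + 1) t) atTop (nhds (S t)) :=
    ⟨fun t => limUnder atTop fun N => F (N + 1) t,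
      fun _ ht => CauchySeq.tendsto_limUnder (hcauchy.cauchySeq ht)⟩
  have hS := hcauchy.tendstoUniformlyOn_of_tendsto hlim
  have hSderiv (t : ℝ) (ht : t ∈ s) := hasDerivAt_of_tendstoUniformlyOn isOpen_Ioo hunif
    (Eventually.of_forall fun N x _ => hderiv N x) hlim ht
  refine ⟨S, fun u hu => ?_, hSderiv, fun hzero t ht => ?_⟩
  · rw [← map_add_atTop_eq_nat 1]
    exact eventually_map.2 (hS u hu)
  · refine (isOpen_Ioo.is_const_of_deriv_eq_zero isPreconnected_Ioo
      (fun x hx => (hSderiv x hx).differentiableAt.differentiableWithinAt)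
      (fun x hx => (hSderiv x hx).deriv.trans (hzero x hx)) ht h0).trans ?_
    exact tendsto_nhds_unique (hlim 0 h0) (by simp_rw [hF0]; exact tendsto_const_nhds)
end

section
/- Let f : ℝ → ℝ be infinitely differentiable and let a > 0. Suppose there exist constants C > 0 and M > 0 such that |f^{(n)}(t)| ≤ C·M^n for every natural number n and every t ∈ (-a, a). Then the series \hat{f}(t) converges uniformly on (-a, a) to the constant f(0); in particular \hat{f}(t) = f(0) for all t ∈ (-a, a). -/
open Filter Finset

/-- The derivative of the partial sums telescopes to a single term. -/
theorem hasDerivAt_sum_pow_mul_iteratedDeriv {f : ℝ → ℝ} (hf : ContDiff ℝ (⊤ : ℕ∞) f)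
    (N : ℕ) (t : ℝ) :
    HasDerivAt (fun t : ℝ => ∑ n ∈ Finset.range (N + 1),
        ((-1 : ℝ) ^ n / (n.factorial : ℝ)) * t ^ n * iteratedDeriv n f t)
      ((-1 : ℝ) ^ N / (N.factorial : ℝ) * t ^ N * iteratedDeriv (N + 1) f t) t := by
  have hd (n : ℕ) : HasDerivAt (iteratedDeriv n f) (iteratedDeriv (n + 1) f t) t := by
    rw [iteratedDeriv_succ]
    exact (hf.differentiable_iteratedDeriv n (by exact_mod_cast WithTop.coe_lt_top n)
      t).hasDerivAt
  induction N with
  | zero => simpa using hd 0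
  | succ N ih =>
    simp_rw [Finset.sum_range_succ _ (N + 1)]
    refine (ih.add (((hasDerivAt_pow (N + 1) t).const_mul
      ((-1 : ℝ) ^ (N + 1) / ((N + 1).factorial : ℝ))).mul (hd (N + 1)))).congr_deriv ?_
    have hN : (N.factorial : ℝ) ≠ 0 := by positivity
    have hN' : (N : ℝ) + 1 ≠ 0 := by positivity
    simp only [Nat.factorial_succ, Nat.cast_mul, Nat.cast_add, Nat.cast_one,
      Nat.add_sub_cancel]
    field_simp
    ring

/-- Mean value estimate for the distance of the partial sums to `f 0`. -/
theorem abs_sum_pow_mul_iteratedDeriv_sub_le {f : ℝ → ℝ} (hf : ContDiff ℝ (⊤ : ℕ∞) f)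
    {a C M : ℝ} (hbound : ∀ n : ℕ, ∀ t ∈ Set.Ioo (-a) a, |iteratedDeriv n f t| ≤ C * M ^ n)
    (N : ℕ) {t : ℝ} (ht : t ∈ Set.Ioo (-a) a) :
    |(∑ n ∈ Finset.range (N + 1),
        ((-1 : ℝ) ^ n / (n.factorial : ℝ)) * t ^ n * iteratedDeriv n f t) - f 0|
      ≤ C * M * a * ((a * M) ^ N / (N.factorial : ℝ)) := by
  have ha : 0 < a := by linarith [ht.1, ht.2]
  have h0 : (0 : ℝ) ∈ Set.Ioo (-a) a := ⟨by linarith, ha⟩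
  have hderiv : ∀ x ∈ Set.Ioo (-a) a,
      ‖(-1 : ℝ) ^ N / (N.factorial : ℝ) * x ^ N * iteratedDeriv (N + 1) f x‖
        ≤ a ^ N / (N.factorial : ℝ) * (C * M ^ (N + 1)) := by
    intro x hx
    have hxa : |x| ≤ a := (abs_lt.2 hx).le
    have hb := hbound (N + 1) x hx
    rw [norm_mul, norm_mul, norm_div, norm_pow, norm_pow, norm_neg, norm_one, one_pow,
      Real.norm_natCast, Real.norm_eq_abs, Real.norm_eq_abs, one_div_mul_eq_div]
    gcongr
  have key := (convex_Ioo (-a) a).norm_image_sub_le_of_norm_hasDerivWithin_le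
    (fun x _ => (hasDerivAt_sum_pow_mul_iteratedDeriv hf N x).hasDerivWithinAt) hderiv h0 ht
  have hzero : ∑ n ∈ Finset.range (N + 1),
      ((-1 : ℝ) ^ n / (n.factorial : ℝ)) * (0 : ℝ) ^ n * iteratedDeriv n f 0 = f 0 := by
    simp [Finset.sum_range_succ']
  rw [hzero, sub_zero, Real.norm_eq_abs, Real.norm_eq_abs] at key
  have hta : |t| ≤ a := (abs_lt.2 ht).le
  have hnn : 0 ≤ a ^ N / (N.factorial : ℝ) * (C * M ^ (N + 1)) :=
    (norm_nonneg _).trans (hderiv 0 h0)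
  calc _ ≤ _ := key
    _ ≤ a ^ N / (N.factorial : ℝ) * (C * M ^ (N + 1)) * a := by gcongr
    _ = _ := by ring

/-- If there are constants `C, M > 0` with `|f^{(n)}(t)| ≤ C M^n` for all `n` and all
`t ∈ (-a, a)`, then the series `∑_{n=0}^∞ ((-1)^n/n!) t^n f^{(n)}(t)` converges uniformly
on `(-a, a)` to the constant `f(0)`; in particular it converges pointwise to `f(0)` there. -/
theorem stmt3 (f : ℝ → ℝ) (hf : ContDiff ℝ (⊤ : ℕ∞) f) (a : ℝ) (ha : 0 < a)
    (C M : ℝ) (hC : 0 < C) (hM : 0 < M)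
    (hbound : ∀ n : ℕ, ∀ t ∈ Set.Ioo (-a) a, |iteratedDeriv n f t| ≤ C * M ^ n) :
    TendstoUniformlyOn
      (fun (N : ℕ) (t : ℝ) => ∑ n ∈ Finset.range N,
        ((-1 : ℝ) ^ n / (n.factorial : ℝ)) * t ^ n * iteratedDeriv n f t)
      (fun _ => f 0) atTop (Set.Ioo (-a) a) ∧
    ∀ t ∈ Set.Ioo (-a) a,
      Filter.Tendsto
        (fun N : ℕ => ∑ n ∈ Finset.range N,
          ((-1 : ℝ) ^ n / (n.factorial : ℝ)) * t ^ n * iteratedDeriv n f t)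
        atTop (nhds (f 0)) := by
  have hunif : TendstoUniformlyOn
      (fun (N : ℕ) (t : ℝ) => ∑ n ∈ Finset.range N,
        ((-1 : ℝ) ^ n / (n.factorial : ℝ)) * t ^ n * iteratedDeriv n f t)
      (fun _ => f 0) atTop (Set.Ioo (-a) a) := by
    rw [Metric.tendstoUniformlyOn_iff]
    intro ε hε
    have hlim : Tendsto (fun N : ℕ => C * M * a * ((a * M) ^ N / (N.factorial : ℝ)))
        atTop (nhds 0) := by
      simpa using (FloorSemiring.tendsto_pow_div_factorial_atTop (a * M)).const_mul (C * M * a)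
    obtain ⟨N₀, hN₀⟩ := eventually_atTop.1 (hlim.eventually_lt_const hε)
    filter_upwards [eventually_ge_atTop (N₀ + 1)] with N hN t ht
    obtain ⟨k, rfl⟩ : ∃ k, N = k + 1 := ⟨N - 1, by omega⟩
    rw [dist_comm, Real.dist_eq]
    exact (abs_sum_pow_mul_iteratedDeriv_sub_le hf hbound k ht).trans_lt (hN₀ k (by omega))
  exact ⟨hunif, fun t ht => hunif.tendsto_at ht⟩
end

section
/- Let f : ℝ → ℝ be infinitely differentiable and let a > 0. Suppose there exists a constant M > 0 such that |∑_{n=0}^{N} (-1)^n f^{(n)}(t)| ≤ M for every natural number N and every t ∈ [0, a]. Then the series \hat{f}(t) converges uniformly on [0, a] (the sequence of partial sums of \hat{f} is uniformly convergent on [0, a], though not necessarily to a constant). -/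
open Filter Finset

/-- If there is a constant `M > 0` with `|∑_{n=0}^{N} (-1)^n f^{(n)}(t)| ≤ M` for every `N`
and every `t ∈ [0, a]`, then the series `∑_{n=0}^∞ ((-1)^n/n!) t^n f^{(n)}(t)` converges
uniformly on `[0, a]` (to some limit function, not necessarily constant). -/
theorem stmt5 (f : ℝ → ℝ) (hf : ContDiff ℝ (⊤ : ℕ∞) f) (a : ℝ) (ha : 0 < a)
    (M : ℝ) (hM : 0 < M)
    (hbound : ∀ N : ℕ, ∀ t ∈ Set.Icc (0 : ℝ) a,
      |∑ n ∈ Finset.range (N + 1), (-1 : ℝ) ^ n * iteratedDeriv n f t| ≤ M) :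
    ∃ S : ℝ → ℝ,
      TendstoUniformlyOn
        (fun (N : ℕ) (t : ℝ) => ∑ n ∈ Finset.range N,
          ((-1 : ℝ) ^ n / (n.factorial : ℝ)) * t ^ n * iteratedDeriv n f t)
        S atTop (Set.Icc (0 : ℝ) a) := by
  have hd : ∀ n : ℕ, ∀ t ∈ Set.Icc (0 : ℝ) a, |iteratedDeriv n f t| ≤ 2 * M := by
    intro n t ht
    have habs : |(-1 : ℝ) ^ n * iteratedDeriv n f t| = |iteratedDeriv n f t| := by
      simp [abs_mul]
    rw [← habs]
    have h1 := hbound n t ht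
    cases n with
    | zero => simp only [zero_add, Finset.sum_range_one] at h1; linarith
    | succ k =>
      have h2 := hbound k t ht
      rw [Finset.sum_range_succ] at h1
      rw [abs_le] at *
      constructor <;> linarith
  refine ⟨_, tendstoUniformlyOn_tsum_nat (u := fun n => 2 * M * (a ^ n / n.factorial))
    ((Real.summable_pow_div_factorial a).mul_left _) ?_⟩
  intro n t ht
  have hp : t ^ n ≤ a ^ n := pow_le_pow_left₀ ht.1 ht.2 n
  have htn : 0 ≤ t ^ n := pow_nonneg ht.1 n
  calc ‖((-1 : ℝ) ^ n / (n.factorial : ℝ)) * t ^ n * iteratedDeriv n f t‖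
      = t ^ n / n.factorial * |iteratedDeriv n f t| := by
        rw [norm_mul, norm_mul, norm_div, norm_pow, norm_neg, norm_one, one_pow,
          Real.norm_of_nonneg htn, Real.norm_of_nonneg (Nat.cast_nonneg _), Real.norm_eq_abs]
        ring
    _ ≤ a ^ n / n.factorial * (2 * M) := by
        gcongr
        exact hd n t ht
    _ = 2 * M * (a ^ n / n.factorial) := mul_comm _ _
end

section
/- Let f, g : ℝ → ℝ be infinitely differentiable and let t ∈ ℝ. Suppose the series \hat{f}(t) converges absolutely and the series \hat{g}(t) converges. Then the series \widehat{f·g}(t) (the series associated to the pointwise product function x ↦ f(x)·g(x)) converges and \widehat{f·g}(t) = \hat{f}(t) · \hat{g}(t); its terms are the Cauchy product of the terms of \hat{f}(t) and \hat{g}(t) via the Leibniz rule (f·g)^{(n)} = ∑_{i=0}^{n} binom(n,i) f^{(i)} g^{(n-i)}. -/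
open Filter Finset

/-- **Mertens' theorem**: the Cauchy product of an absolutely convergent series with a convergent
series converges to the product of the sums. -/
theorem tendsto_sum_range_cauchyProduct {𝕜 : Type*} [NormedField 𝕜] {a b : ℕ → 𝕜} {A B : 𝕜}
    (ha : Summable fun n => ‖a n‖)
    (hA : Tendsto (fun N => ∑ n ∈ range N, a n) atTop (nhds A))
    (hB : Tendsto (fun N => ∑ n ∈ range N, b n) atTop (nhds B)) :
    Tendsto (fun N => ∑ n ∈ range N, ∑ m ∈ range (n + 1), a m * b (n - m))
      atTop (nhds (A * B)) := by
  have ha' : IsCauSeq abs fun m => ∑ n ∈ range m, ‖a n‖ :=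
    ha.hasSum.tendsto_sum_nat.cauchySeq.isCauSeq
  have hb' : IsCauSeq norm fun m => ∑ n ∈ range m, b n := hB.cauchySeq.isCauSeq
  have hdiff : Tendsto (fun N => (∑ n ∈ range N, a n) * (∑ n ∈ range N, b n) -
      ∑ n ∈ range N, ∑ m ∈ range (n + 1), a m * b (n - m)) atTop (nhds 0) := by
    refine Metric.tendsto_atTop.2 fun ε hε => ?_
    simpa only [dist_zero_right] using cauchy_product ha' hb' ε hε
  simpa using (hA.mul hB).sub hdiff

/-- The terms of the series `∑ (-1)ⁿ / n! * tⁿ * (f g)⁽ⁿ⁾(t)` are the Cauchy product of the terms of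
the series of `f` and of `g`. -/
theorem taylorTerm_mul {f g : ℝ → ℝ} {t : ℝ} {n : ℕ}
    (hf : ContDiffAt ℝ n f t) (hg : ContDiffAt ℝ n g t) :
    ((-1 : ℝ) ^ n / (n.factorial : ℝ)) * t ^ n * iteratedDeriv n (fun x => f x * g x) t =
      ∑ m ∈ range (n + 1),
        (((-1 : ℝ) ^ m / (m.factorial : ℝ)) * t ^ m * iteratedDeriv m f t) *
        (((-1 : ℝ) ^ (n - m) / ((n - m).factorial : ℝ)) * t ^ (n - m) *
          iteratedDeriv (n - m) g t) := by
  rw [iteratedDeriv_fun_mul hf hg, mul_sum]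
  refine sum_congr rfl fun m hm => ?_
  have hmn : m ≤ n := Nat.lt_succ_iff.1 (mem_range.1 hm)
  rw [Nat.cast_choose ℝ hmn, ← pow_mul_pow_sub (-1 : ℝ) hmn, ← pow_mul_pow_sub t hmn]
  field_simp

/-- Mertens-type product rule: if `\hat{f}(t)` converges absolutely (with sum `Lf`) and
`\hat{g}(t)` converges (with sum `Lg`), then the series associated to the pointwise
product `x ↦ f(x) g(x)` at `t` converges and its sum is `Lf * Lg`. -/
theorem stmt9 (f g : ℝ → ℝ) (hf : ContDiff ℝ (⊤ : ℕ∞) f) (hg : ContDiff ℝ (⊤ : ℕ∞) g)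
    (t Lf Lg : ℝ)
    (hfabs : Summable (fun n : ℕ =>
      |((-1 : ℝ) ^ n / (n.factorial : ℝ)) * t ^ n * iteratedDeriv n f t|))
    (hfc : Filter.Tendsto
      (fun N : ℕ => ∑ n ∈ Finset.range N,
        ((-1 : ℝ) ^ n / (n.factorial : ℝ)) * t ^ n * iteratedDeriv n f t)
      Filter.atTop (nhds Lf))
    (hgc : Filter.Tendsto
      (fun N : ℕ => ∑ n ∈ Finset.range N,
        ((-1 : ℝ) ^ n / (n.factorial : ℝ)) * t ^ n * iteratedDeriv n g t)
      Filter.atTop (nhds Lg)) :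
    Filter.Tendsto
      (fun N : ℕ => ∑ n ∈ Finset.range N,
        ((-1 : ℝ) ^ n / (n.factorial : ℝ)) * t ^ n *
          iteratedDeriv n (fun x => f x * g x) t)
      Filter.atTop (nhds (Lf * Lg)) := by
  simp_rw [fun n : ℕ => taylorTerm_mul (t := t) (n := n)
    (hf.contDiffAt.of_le (mod_cast le_top)) (hg.contDiffAt.of_le (mod_cast le_top))]
  exact tendsto_sum_range_cauchyProduct
    (a := fun n => ((-1 : ℝ) ^ n / (n.factorial : ℝ)) * t ^ n * iteratedDeriv n f t)
    (b := fun n => ((-1 : ℝ) ^ n / (n.factorial : ℝ)) * t ^ n * iteratedDeriv n g t)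
    hfabs hfc hgc
end

section
/- Let f : ℝ → ℝ be infinitely differentiable and let a > 0. Suppose the series \hat{f} converges uniformly on (-a, a) (the sequence of partial sums of t ↦ ∑_{n=0}^{N} ((-1)^n/n!) t^n f^{(n)}(t) converges uniformly on (-a, a), not necessarily to a constant). Define F : ℝ → ℝ by F(x) := ∫_0^x f(t) dt. Then the series \hat{F}(x) converges uniformly on (-a, a) to the constant F(0) = 0; in particular \hat{F}(x) = 0 for every x ∈ (-a, a). -/
open Filter Finset

/-- The derivative of the partial sums of `\hat{F}` telescopes to a single term. -/
theorem hasDerivAt_sum_taylor_reflected {F : ℝ → ℝ} (hF : ContDiff ℝ (⊤ : ℕ∞) F) (N : ℕ) (x : ℝ) :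
    HasDerivAt
      (fun y : ℝ => ∑ n ∈ Finset.range (N + 1),
        ((-1 : ℝ) ^ n / (n.factorial : ℝ)) * y ^ n * iteratedDeriv n F y)
      (((-1 : ℝ) ^ N / (N.factorial : ℝ)) * x ^ N * iteratedDeriv (N + 1) F x) x := by
  have hd (n : ℕ) : HasDerivAt (iteratedDeriv n F) (iteratedDeriv (n + 1) F x) x := by
    rw [iteratedDeriv_succ]
    exact (hF.differentiable_iteratedDeriv n (by exact_mod_cast ENat.natCast_lt_top n) x).hasDerivAt
  induction N with
  | zero => simpa using hd 0
  | succ N ih =>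
    have hterm := ((hasDerivAt_pow (N + 1) x).const_mul
      ((-1 : ℝ) ^ (N + 1) / ((N + 1).factorial : ℝ))).mul (hd (N + 1))
    simp only [Finset.sum_range_succ _ (N + 1)]
    refine (ih.add hterm).congr_deriv ?_
    have hN : (N.factorial : ℝ) ≠ 0 := by positivity
    have hN' : (N : ℝ) + 1 ≠ 0 := by positivity
    rw [Nat.factorial_succ]
    push_cast
    field_simp
    ring

/-- The terms of a uniformly convergent series tend to zero uniformly. -/
theorem TendstoUniformlyOn.eventually_norm_term_lt {u : ℕ → ℝ → ℝ} {S : ℝ → ℝ} {s : Set ℝ}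
    (h : TendstoUniformlyOn (fun N t => ∑ n ∈ Finset.range N, u n t) S atTop s)
    {ε : ℝ} (hε : 0 < ε) : ∀ᶠ N in atTop, ∀ t ∈ s, ‖u N t‖ < ε := by
  have h1 := Metric.tendstoUniformlyOn_iff.1 h (ε / 2) (half_pos hε)
  filter_upwards [h1, (tendsto_add_atTop_nat 1).eventually h1] with N hN hN' t ht
  have h2 := hN t ht
  have h3 := hN' t ht
  rw [Real.dist_eq, abs_lt] at h2 h3
  rw [Finset.sum_range_succ] at h3
  rw [Real.norm_eq_abs, abs_lt]
  constructor <;> linarith [h2.1, h2.2, h3.1, h3.2]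

/-- If the series `\hat{f}` converges uniformly on `(-a, a)` (to some limit function, not
necessarily constant), then for the antiderivative `F(x) = ∫_0^x f(t) dt` the series
`\hat{F}` converges uniformly on `(-a, a)` to the constant `F(0) = 0`; in particular
`\hat{F}(x) = 0` for every `x ∈ (-a, a)`. -/
theorem stmt11 (f : ℝ → ℝ) (hf : ContDiff ℝ (⊤ : ℕ∞) f) (a : ℝ) (ha : 0 < a)
    (hunif : ∃ S : ℝ → ℝ,
      TendstoUniformlyOn
        (fun (N : ℕ) (t : ℝ) => ∑ n ∈ Finset.range N,
          ((-1 : ℝ) ^ n / (n.factorial : ℝ)) * t ^ n * iteratedDeriv n f t)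
        S atTop (Set.Ioo (-a) a)) :
    TendstoUniformlyOn
      (fun (N : ℕ) (x : ℝ) => ∑ n ∈ Finset.range N,
        ((-1 : ℝ) ^ n / (n.factorial : ℝ)) * x ^ n *
          iteratedDeriv n (fun y => ∫ s in (0 : ℝ)..y, f s) x)
      (fun _ => 0) atTop (Set.Ioo (-a) a) ∧
    ∀ x ∈ Set.Ioo (-a) a,
      Filter.Tendsto
        (fun N : ℕ => ∑ n ∈ Finset.range N,
          ((-1 : ℝ) ^ n / (n.factorial : ℝ)) * x ^ n *
            iteratedDeriv n (fun y => ∫ s in (0 : ℝ)..y, f s) x)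
        Filter.atTop (nhds 0) := by
  have hderiv (x : ℝ) : HasDerivAt (fun y => ∫ s in (0 : ℝ)..y, f s) (f x) x :=
    intervalIntegral.integral_hasDerivAt_right (hf.continuous.intervalIntegrable _ _)
      hf.continuous.stronglyMeasurable.stronglyMeasurableAtFilter hf.continuous.continuousAt
  have hF0 : (fun y => ∫ s in (0 : ℝ)..y, f s) 0 = 0 := intervalIntegral.integral_same
  generalize (fun y => ∫ s in (0 : ℝ)..y, f s) = F at hderiv hF0 ⊢
  have hdF : deriv F = f := funext fun x => (hderiv x).deriv
  have hF : ContDiff ℝ (⊤ : ℕ∞) F :=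
    contDiff_infty_iff_deriv.2 ⟨fun x => (hderiv x).differentiableAt, hdF ▸ hf⟩
  obtain ⟨S, hS⟩ := hunif
  suffices hmain : TendstoUniformlyOn
      (fun (N : ℕ) (x : ℝ) => ∑ n ∈ Finset.range N,
        ((-1 : ℝ) ^ n / (n.factorial : ℝ)) * x ^ n * iteratedDeriv n F x)
      (fun _ => 0) atTop (Set.Ioo (-a) a) from
    ⟨hmain, fun x hx => hmain.tendsto_at hx⟩
  refine Metric.tendstoUniformlyOn_iff.2 fun ε hε => ?_
  rw [← map_add_atTop_eq_nat 1, eventually_map]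
  filter_upwards [hS.eventually_norm_term_lt (div_pos hε ha)] with N hN x hx
  have hmv := (convex_Ioo (-a) a).norm_image_sub_le_of_norm_hasDerivWithin_le
    (fun y _ => (hasDerivAt_sum_taylor_reflected hF N y).hasDerivWithinAt)
    (fun y hy => by
      rw [iteratedDeriv_succ', hdF]
      exact (hN y hy).le) (show (0 : ℝ) ∈ Set.Ioo (-a) a by simp [ha]) hx
  have hzero : ∑ n ∈ Finset.range (N + 1),
      ((-1 : ℝ) ^ n / (n.factorial : ℝ)) * (0 : ℝ) ^ n * iteratedDeriv n F 0 = 0 := by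
    simp [Finset.sum_range_succ', hF0]
  rw [hzero, sub_zero, sub_zero] at hmv
  rw [dist_zero_left]
  calc _ ≤ ε / a * ‖x‖ := hmv
    _ < ε / a * a := by
      have : ‖x‖ < a := abs_lt.2 hx
      gcongr
    _ = ε := div_mul_cancel₀ _ ha.ne'
end

section
/- Let f : ℝ → ℝ be infinitely differentiable and let R > 0. Suppose f equals its Taylor series at the origin on (-R, R), i.e. for every t with |t| < R the series ∑_{n=0}^∞ (f^{(n)}(0)/n!) t^n converges to f(t). Then for every t with |t| < R/2, the series \hat{f}(t) converges absolutely and \hat{f}(t) = f(0). Moreover, if the hypothesis holds for every R > 0, then \hat{f}(t) = f(0) for every t ∈ ℝ. -/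
open Filter Finset

/-- A real function with `f t = ∑ aₙ tⁿ` on `(-R, R)` has the corresponding power series on the
ball of radius `R` around the origin. -/
theorem hasFPowerSeriesOnBall_ofScalars_of_hasSum {f : ℝ → ℝ} {a : ℕ → ℝ} {R : ℝ} (hR : 0 < R)
    (h : ∀ t : ℝ, |t| < R → HasSum (fun n : ℕ => a n * t ^ n) (f t)) :
    HasFPowerSeriesOnBall f (FormalMultilinearSeries.ofScalars ℝ a) 0 (ENNReal.ofReal R) where
  r_le := by
    refine ENNReal.le_of_forall_nnreal_lt fun r hr => ?_
    have hrR : |(r : ℝ)| < R := by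
      rw [abs_of_nonneg r.coe_nonneg]
      exact (ENNReal.lt_ofReal_iff_toReal_lt ENNReal.coe_ne_top).1 hr
    refine FormalMultilinearSeries.le_radius_of_tendsto (l := 0) _ ?_
    simpa [FormalMultilinearSeries.ofScalars_norm] using
      (h r hrR).summable.tendsto_atTop_zero.norm
  r_pos := ENNReal.ofReal_pos.2 hR
  hasSum := by
    intro y hy
    have hyR : |y| < R := by
      rw [Metric.eball_ofReal] at hy
      simpa using hy
    simpa [FormalMultilinearSeries.ofScalars_apply_eq, mul_comm] using h y hyR

/-- The Taylor expansion at `t`, evaluated at the origin, for a function given by a power series on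
`(-R, R)` and `|t| < R / 2`. -/
theorem hasSum_iteratedDeriv_mul_neg_pow {f : ℝ → ℝ} {a : ℕ → ℝ} {R : ℝ}
    (h : ∀ t : ℝ, |t| < R → HasSum (fun n : ℕ => a n * t ^ n) (f t)) {t : ℝ} (ht : |t| < R / 2) :
    HasSum (fun n : ℕ => (-1 : ℝ) ^ n / (n.factorial : ℝ) * t ^ n * iteratedDeriv n f t)
      (f 0) := by
  have hR : 0 < R := by linarith [abs_nonneg t]
  have hnorm : (‖t‖₊ : ENNReal) = ENNReal.ofReal |t| := by
    rw [← Real.norm_eq_abs, ofReal_norm, enorm_eq_nnnorm]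
  have hlt : (‖t‖₊ : ENNReal) < ENNReal.ofReal R := by
    rw [hnorm]
    exact (ENNReal.ofReal_lt_ofReal_iff hR).2 (by linarith)
  have hmem : -t ∈ Metric.eball (0 : ℝ) (ENNReal.ofReal R - ‖t‖₊) := by
    rw [hnorm, ← ENNReal.ofReal_sub _ (abs_nonneg t), Metric.eball_ofReal, mem_ball_zero_iff,
      norm_neg, Real.norm_eq_abs]
    linarith
  have key :=
    ((hasFPowerSeriesOnBall_ofScalars_of_hasSum hR h).changeOrigin hlt).hasSum_iteratedFDeriv hmem
  simp only [zero_add, add_neg_cancel, iteratedFDeriv_apply_eq_iteratedDeriv_mul_prod,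
    Finset.prod_const, Finset.card_univ, Fintype.card_fin, smul_eq_mul] at key
  refine key.congr_fun fun n => ?_
  rw [neg_pow]
  ring

/-- If `f` equals its Taylor series at the origin on `(-R, R)`, then for every `|t| < R/2`
the series `\hat{f}(t)` converges absolutely to `f(0)`. Moreover, if the Taylor expansion
is valid on all of `ℝ` (i.e. for every `R > 0`), then `\hat{f}(t) = f(0)` for every real
`t`. -/
theorem stmt12 (f : ℝ → ℝ) (hf : ContDiff ℝ (⊤ : ℕ∞) f) (R : ℝ) (hR : 0 < R)
    (htaylor : ∀ t : ℝ, |t| < R →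
      HasSum (fun n : ℕ => iteratedDeriv n f 0 / (n.factorial : ℝ) * t ^ n) (f t)) :
    (∀ t : ℝ, |t| < R / 2 →
      Summable (fun n : ℕ => |t| ^ n / (n.factorial : ℝ) * |iteratedDeriv n f t|) ∧
      Filter.Tendsto
        (fun N : ℕ => ∑ n ∈ Finset.range N,
          ((-1 : ℝ) ^ n / (n.factorial : ℝ)) * t ^ n * iteratedDeriv n f t)
        Filter.atTop (nhds (f 0))) ∧
    ((∀ R' : ℝ, 0 < R' → ∀ t : ℝ, |t| < R' →
        HasSum (fun n : ℕ => iteratedDeriv n f 0 / (n.factorial : ℝ) * t ^ n) (f t)) →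
      ∀ t : ℝ,
        Filter.Tendsto
          (fun N : ℕ => ∑ n ∈ Finset.range N,
            ((-1 : ℝ) ^ n / (n.factorial : ℝ)) * t ^ n * iteratedDeriv n f t)
          Filter.atTop (nhds (f 0))) := by
  refine ⟨fun t ht => ?_, fun h t => ?_⟩
  · have key := hasSum_iteratedDeriv_mul_neg_pow htaylor ht
    refine ⟨key.summable.abs.congr fun n => ?_, key.tendsto_sum_nat⟩
    simp only [abs_mul, abs_div, abs_pow, abs_neg, abs_one, one_pow, Nat.abs_cast]
    ring
  · have hpos : 0 < 2 * |t| + 1 := by positivity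
    exact (hasSum_iteratedDeriv_mul_neg_pow (h _ hpos) (by linarith)).tendsto_sum_nat
end

section
/- Let f : ℝ → ℝ be infinitely differentiable and let t ≠ 0. Suppose f equals its Taylor series at t on the open interval {x : |x - t| < |t|}, i.e. for every x with |x - t| < |t| the series ∑_{n=0}^∞ (f^{(n)}(t)/n!)(x - t)^n converges to f(x), and suppose the series \hat{f}(t) converges. Then \hat{f}(t) = f(0). (This is Abel's limit theorem applied at the boundary point 0 of the interval of convergence, together with continuity of f at 0.) -/
open Filter Finset

/-- Abel's theorem case: if `f` equals its Taylor series at `t ≠ 0` on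
`{x : |x - t| < |t|}` and the series `\hat{f}(t)` converges, then `\hat{f}(t) = f(0)`. -/
theorem stmt16 (f : ℝ → ℝ) (hf : ContDiff ℝ (⊤ : ℕ∞) f) (t : ℝ) (ht : t ≠ 0)
    (htaylor : ∀ x : ℝ, |x - t| < |t| →
      HasSum (fun n : ℕ => iteratedDeriv n f t / (n.factorial : ℝ) * (x - t) ^ n) (f x))
    (hconv : ∃ L : ℝ, Filter.Tendsto
      (fun N : ℕ => ∑ n ∈ Finset.range N,
        ((-1 : ℝ) ^ n / (n.factorial : ℝ)) * t ^ n * iteratedDeriv n f t)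
      Filter.atTop (nhds L)) :
    Filter.Tendsto
      (fun N : ℕ => ∑ n ∈ Finset.range N,
        ((-1 : ℝ) ^ n / (n.factorial : ℝ)) * t ^ n * iteratedDeriv n f t)
      Filter.atTop (nhds (f 0)) := by
  obtain ⟨L, hL⟩ := hconv
  have h_abel := Real.tendsto_tsum_powerSeries_nhdsWithin_lt hL
  have h_eq : ∀ᶠ s in nhdsWithin (1 : ℝ) (Set.Iio 1),
      ∑' n : ℕ, ((-1 : ℝ) ^ n / (n.factorial : ℝ)) * t ^ n * iteratedDeriv n f t * s ^ n =
        f (t - t * s) := by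
    filter_upwards [Ioo_mem_nhdsLT (show (0 : ℝ) < 1 by norm_num)] with s hs
    have h_dist : |t - t * s - t| < |t| := by
      rw [show t - t * s - t = -(t * s) by ring, abs_neg, abs_mul, abs_of_pos hs.1]
      exact mul_lt_of_lt_one_right (abs_pos.mpr ht) hs.2
    rw [← (htaylor _ h_dist).tsum_eq]
    refine tsum_congr fun n => ?_
    rw [show t - t * s - t = -1 * t * s by ring, mul_pow, mul_pow]
    ring
  have h_cont : Tendsto (fun s => f (t - t * s)) (nhdsWithin 1 (Set.Iio 1)) (nhds (f 0)) := by
    have h_continuous : Continuous fun s => f (t - t * s) :=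
      hf.continuous.comp (by fun_prop)
    exact (h_continuous.tendsto' 1 (f 0) (by simp)).mono_left nhdsWithin_le_nhds
  rwa [tendsto_nhds_unique (h_abel.congr' h_eq) h_cont] at hL
end

section
/- Let u : ℝ → ℝ be infinitely differentiable such that for each natural number k there exists a constant M_k with |u^{(k)}(x)| ≤ M_k for all x ∈ ℝ, and let (a_n) be a sequence of nonnegative real numbers such that the power series ∑_{n=0}^∞ a_n x^n converges for every x ∈ ℝ. Then the series f(x) := ∑_{n=0}^∞ a_n u(2^n x) converges for every x ∈ ℝ, the function f is infinitely differentiable on ℝ, and for every natural number k and every x ∈ ℝ, f^{(k)}(x) = ∑_{n=0}^∞ a_n 2^{kn} u^{(k)}(2^n x). -/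
open Filter Finset

/-- A dilation-type series whose coefficients decay fast enough converges absolutely. -/
theorem summable_mul_two_pow_mul_of_bounded {v : ℝ → ℝ} {C : ℝ} (hv : ∀ x, |v x| ≤ C)
    {a : ℕ → ℝ} (ha : ∀ n, 0 ≤ a n) {k : ℕ} (hk : Summable fun n : ℕ => a n * 2 ^ (k * n))
    (x : ℝ) : Summable fun n : ℕ => a n * 2 ^ (k * n) * v (2 ^ n * x) := by
  refine Summable.of_norm_bounded (hk.mul_right C) fun n => ?_
  have h : 0 ≤ a n * 2 ^ (k * n) := mul_nonneg (ha n) (by positivity)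
  rw [norm_mul, Real.norm_of_nonneg h]
  exact mul_le_mul_of_nonneg_left (hv _) h

/-- Termwise differentiation of `∑ aₙ 2^{kn} v(2ⁿ x)` for `v` bounded with bounded derivative. -/
theorem hasDerivAt_tsum_mul_two_pow_mul {v v' : ℝ → ℝ} {C C' : ℝ}
    (hderiv : ∀ x, HasDerivAt v (v' x) x) (hv : ∀ x, |v x| ≤ C) (hv' : ∀ x, |v' x| ≤ C')
    {a : ℕ → ℝ} (ha : ∀ n, 0 ≤ a n) {k : ℕ} (hk : Summable fun n : ℕ => a n * 2 ^ (k * n))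
    (hk' : Summable fun n : ℕ => a n * 2 ^ ((k + 1) * n)) (x : ℝ) :
    HasDerivAt (fun x : ℝ => ∑' n : ℕ, a n * 2 ^ (k * n) * v (2 ^ n * x))
      (∑' n : ℕ, a n * 2 ^ ((k + 1) * n) * v' (2 ^ n * x)) x := by
  refine hasDerivAt_tsum (g := fun n x => a n * 2 ^ (k * n) * v (2 ^ n * x))
    (g' := fun n x => a n * 2 ^ ((k + 1) * n) * v' (2 ^ n * x)) (y₀ := 0) (hk'.mul_right C')
    (fun n y => ?_) (fun n y => ?_)
    (summable_mul_two_pow_mul_of_bounded hv ha hk 0) x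
  · have hlin : HasDerivAt (fun y : ℝ => 2 ^ n * y) (2 ^ n) y := by
      simpa using (hasDerivAt_id y).const_mul ((2 : ℝ) ^ n)
    refine (((hderiv (2 ^ n * y)).comp y hlin).const_mul (a n * 2 ^ (k * n))).congr_deriv ?_
    ring
  · have h : 0 ≤ a n * 2 ^ ((k + 1) * n) := mul_nonneg (ha n) (by positivity)
    rw [norm_mul, Real.norm_of_nonneg h]
    exact mul_le_mul_of_nonneg_left (hv' _) h

/-- Let `u : ℝ → ℝ` be smooth with all derivatives uniformly bounded (`|u^{(k)}(x)| ≤ M_k`)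
and let `(a_n)` be nonnegative with `∑ a_n x^n` convergent for every real `x`. Then
`f(x) = ∑_{n=0}^∞ a_n u(2^n x)` converges for every `x`, defines a smooth function, and
`f^{(k)}(x) = ∑_{n=0}^∞ a_n 2^{kn} u^{(k)}(2^n x)` for every `k` and `x`. -/
theorem stmt17 (u : ℝ → ℝ) (hu : ContDiff ℝ (⊤ : ℕ∞) u)
    (M : ℕ → ℝ) (hM : ∀ (k : ℕ) (x : ℝ), |iteratedDeriv k u x| ≤ M k)
    (a : ℕ → ℝ) (ha : ∀ n, 0 ≤ a n)
    (hconv : ∀ x : ℝ, Summable (fun n : ℕ => a n * x ^ n)) :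
    (∀ x : ℝ, Summable (fun n : ℕ => a n * u (2 ^ n * x))) ∧
    ContDiff ℝ (⊤ : ℕ∞) (fun x : ℝ => ∑' n : ℕ, a n * u (2 ^ n * x)) ∧
    ∀ (k : ℕ) (x : ℝ),
      iteratedDeriv k (fun x : ℝ => ∑' n : ℕ, a n * u (2 ^ n * x)) x
        = ∑' n : ℕ, a n * 2 ^ (k * n) * iteratedDeriv k u (2 ^ n * x) := by
  have hsum (k : ℕ) : Summable fun n : ℕ => a n * 2 ^ (k * n) := by
    simpa only [pow_mul] using hconv (2 ^ k)
  have hu' (k : ℕ) (x : ℝ) :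
      HasDerivAt (iteratedDeriv k u) (iteratedDeriv (k + 1) u x) x := by
    rw [iteratedDeriv_succ]
    exact (hu.differentiable_iteratedDeriv k (by exact_mod_cast WithTop.coe_lt_top k) x).hasDerivAt
  have hf (k : ℕ) (x : ℝ) := hasDerivAt_tsum_mul_two_pow_mul (hu' k) (hM k) (hM (k + 1)) ha
    (hsum k) (hsum (k + 1)) x
  have hformula (k : ℕ) : iteratedDeriv k (fun x : ℝ => ∑' n : ℕ, a n * u (2 ^ n * x))
      = fun x => ∑' n : ℕ, a n * 2 ^ (k * n) * iteratedDeriv k u (2 ^ n * x) := by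
    induction k with
    | zero => simp
    | succ k ih =>
      rw [iteratedDeriv_succ, ih]
      exact funext fun x => (hf k x).deriv
  refine ⟨fun x => ?_, contDiff_of_differentiable_iteratedDeriv fun k _ => ?_,
    fun k x => congrFun (hformula k) x⟩
  · simpa using summable_mul_two_pow_mul_of_bounded (hM 0) ha (hsum 0) x
  · rw [hformula k]
    exact fun x => (hf k x).differentiableAt
end

section
/- Let ℓ > 0 and let u : ℝ → ℝ be infinitely differentiable such that: u is periodic with period ℓ; u(x) > 0 for every x not of the form mℓ with m ∈ ℤ; u^{(n)}(0) = 0 for every natural number n; for each natural number k there exists a constant M_k with |u^{(k)}(x)| ≤ M_k for all x; and u is real-analytic at every point x not of the form mℓ with m ∈ ℤ. Let (a_n) be a sequence of strictly positive real numbers such that the power series ∑_{n=0}^∞ a_n x^n converges for every x ∈ ℝ. Then the function f(x) := ∑_{n=0}^∞ a_n u(2^n x) is infinitely differentiable on ℝ and is nowhere real-analytic: there is no point a ∈ ℝ at which f is real-analytic. -/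
open Filter Finset

/-- The derivatives of the dilates `c * u (2 ^ n * x)`. -/
lemma iteratedDeriv_const_mul_comp_two_pow_mul {u : ℝ → ℝ} (hu : ContDiff ℝ (⊤ : ℕ∞) u)
    (c : ℝ) (n k : ℕ) (x : ℝ) :
    iteratedDeriv k (fun x : ℝ => c * u (2 ^ n * x)) x
      = c * (((2 : ℝ) ^ n) ^ k * iteratedDeriv k u (2 ^ n * x)) := by
  rw [iteratedDeriv_const_mul_field,
    iteratedDeriv_comp_const_mul (hu.of_le (by exact_mod_cast le_top))]

lemma norm_iteratedFDeriv_const_mul_comp_two_pow_mul_le {u : ℝ → ℝ}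
    (hu : ContDiff ℝ (⊤ : ℕ∞) u) {M : ℕ → ℝ}
    (hM : ∀ (k : ℕ) (x : ℝ), |iteratedDeriv k u x| ≤ M k) {c : ℝ} (hc : 0 < c)
    (n k : ℕ) (x : ℝ) :
    ‖iteratedFDeriv ℝ k (fun x : ℝ => c * u (2 ^ n * x)) x‖
      ≤ c * ((2 : ℝ) ^ k) ^ n * M k := by
  rw [norm_iteratedFDeriv_eq_norm_iteratedDeriv,
    iteratedDeriv_const_mul_comp_two_pow_mul hu, Real.norm_eq_abs, abs_mul, abs_mul,
    abs_of_pos hc, abs_of_pos (by positivity), mul_assoc, pow_right_comm]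
  gcongr
  exact hM k _

lemma contDiff_const_mul_comp_two_pow_mul {u : ℝ → ℝ} (hu : ContDiff ℝ (⊤ : ℕ∞) u)
    (c : ℝ) (n : ℕ) : ContDiff ℝ (⊤ : ℕ∞) (fun x : ℝ => c * u (2 ^ n * x)) :=
  contDiff_const.mul (hu.comp (contDiff_const.mul contDiff_id))

lemma contDiff_tsum_two_pow_mul {u : ℝ → ℝ} (hu : ContDiff ℝ (⊤ : ℕ∞) u) {M : ℕ → ℝ}
    (hM : ∀ (k : ℕ) (x : ℝ), |iteratedDeriv k u x| ≤ M k) {a : ℕ → ℝ} (ha : ∀ n, 0 < a n)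
    (hconv : ∀ x : ℝ, Summable (fun n : ℕ => a n * x ^ n)) :
    ContDiff ℝ (⊤ : ℕ∞) (fun x : ℝ => ∑' n : ℕ, a n * u (2 ^ n * x)) :=
  contDiff_tsum (fun n => contDiff_const_mul_comp_two_pow_mul hu (a n) n)
    (fun k _ => (hconv (2 ^ k)).mul_right (M k))
    (fun k n x _ => norm_iteratedFDeriv_const_mul_comp_two_pow_mul_le hu hM (ha n) n k x)

lemma summable_two_pow_mul {u : ℝ → ℝ} {C : ℝ} (hC : ∀ x, |u x| ≤ C)
    {a : ℕ → ℝ} (ha : ∀ n, 0 < a n) (hsum : Summable a) (x : ℝ) :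
    Summable (fun n : ℕ => a n * u (2 ^ n * x)) := by
  refine Summable.of_norm_bounded (hsum.mul_right C) fun n => ?_
  rw [Real.norm_eq_abs, abs_mul, abs_of_pos (ha n)]
  exact mul_le_mul_of_nonneg_left (hC _) (ha n).le

/-- If `u` is flat at `0`, so is the sum of its dilates. -/
lemma iteratedDeriv_tsum_two_pow_mul_zero {u : ℝ → ℝ} (hu : ContDiff ℝ (⊤ : ℕ∞) u)
    (hflat : ∀ n : ℕ, iteratedDeriv n u 0 = 0) {M : ℕ → ℝ}
    (hM : ∀ (k : ℕ) (x : ℝ), |iteratedDeriv k u x| ≤ M k) {a : ℕ → ℝ} (ha : ∀ n, 0 < a n)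
    (hconv : ∀ x : ℝ, Summable (fun n : ℕ => a n * x ^ n)) (k : ℕ) :
    iteratedDeriv k (fun x : ℝ => ∑' n : ℕ, a n * u (2 ^ n * x)) 0 = 0 := by
  have h : iteratedFDeriv ℝ k (fun x : ℝ => ∑' n : ℕ, a n * u (2 ^ n * x)) 0 = 0 := by
    rw [iteratedFDeriv_tsum_apply (N := ⊤)
      (fun n => contDiff_const_mul_comp_two_pow_mul hu (a n) n)
      (fun k _ => (hconv (2 ^ k)).mul_right (M k))
      (fun k n x _ => norm_iteratedFDeriv_const_mul_comp_two_pow_mul_le hu hM (ha n) n k x)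
      le_top]
    have h0 (n : ℕ) : iteratedFDeriv ℝ k (fun x : ℝ => a n * u (2 ^ n * x)) 0 = 0 := by
      rw [← norm_eq_zero, norm_iteratedFDeriv_eq_norm_iteratedDeriv,
        iteratedDeriv_const_mul_comp_two_pow_mul hu, mul_zero, hflat]
      simp
    simp [h0]
  rw [iteratedDeriv, h]
  rfl

/-- A real-analytic function that is flat at a point vanishes near that point. -/
lemma AnalyticAt.eventually_eq_zero_of_iteratedDeriv_eq_zero {f : ℝ → ℝ} {x : ℝ}
    (hf : AnalyticAt ℝ f x) (h : ∀ n, iteratedDeriv n f x = 0) : ∀ᶠ z in nhds x, f z = 0 := by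
  refine HasFPowerSeriesAt.eventually_eq_zero (𝕜 := ℝ) ?_
  convert! hf.hasFPowerSeriesAt
  ext n
  simp [h, FormalMultilinearSeries.ofScalars]

lemma nonneg_of_pos_off_lattice {ℓ : ℝ} {u : ℝ → ℝ} (hper : Function.Periodic u ℓ)
    (hpos : ∀ x : ℝ, (∀ m : ℤ, x ≠ (m : ℝ) * ℓ) → 0 < u x) (h0 : u 0 = 0) (x : ℝ) :
    0 ≤ u x := by
  by_cases hx : ∀ m : ℤ, x ≠ (m : ℝ) * ℓ
  · exact (hpos x hx).le
  · push Not at hx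
    obtain ⟨m, rfl⟩ := hx
    rw [hper.int_mul_eq, h0]

lemma not_analyticAt_tsum_two_pow_mul_zero {ℓ : ℝ} (hℓ : 0 < ℓ) {u : ℝ → ℝ}
    (hu : ContDiff ℝ (⊤ : ℕ∞) u) (hper : Function.Periodic u ℓ)
    (hpos : ∀ x : ℝ, (∀ m : ℤ, x ≠ (m : ℝ) * ℓ) → 0 < u x)
    (hflat : ∀ n : ℕ, iteratedDeriv n u 0 = 0) {M : ℕ → ℝ}
    (hM : ∀ (k : ℕ) (x : ℝ), |iteratedDeriv k u x| ≤ M k) {a : ℕ → ℝ} (ha : ∀ n, 0 < a n)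
    (hconv : ∀ x : ℝ, Summable (fun n : ℕ => a n * x ^ n)) :
    ¬ AnalyticAt ℝ (fun x : ℝ => ∑' n : ℕ, a n * u (2 ^ n * x)) 0 := by
  intro hf
  have hev := hf.eventually_eq_zero_of_iteratedDeriv_eq_zero
    (iteratedDeriv_tsum_two_pow_mul_zero hu hflat hM ha hconv)
  obtain ⟨ε, hε, hball⟩ := Metric.eventually_nhds_iff.1 hev
  set x := min (ε / 2) (ℓ / 2) with hx
  have hx0 : 0 < x := by positivity
  have hxε : x < ε := (min_le_left _ _).trans_lt (half_lt_self hε)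
  have hxℓ : x < ℓ := (min_le_right _ _).trans_lt (half_lt_self hℓ)
  have hux : 0 < u x := by
    refine hpos x fun m hm => ?_
    have h1 : (0 : ℝ) < m := by
      by_contra! h
      nlinarith
    have h2 : (m : ℝ) < 1 := by
      by_contra! h
      nlinarith
    norm_cast at h1 h2
    lia
  have hzero := hball (y := x) (by rwa [Real.dist_eq, sub_zero, abs_of_pos hx0])
  have hu0 : u 0 = 0 := by simpa using hflat 0
  have hnonneg := nonneg_of_pos_off_lattice hper hpos hu0
  have hsum := summable_two_pow_mul (C := M 0) (fun x => by simpa using hM 0 x) ha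
    (by simpa using hconv 1) x
  have := hsum.tsum_pos (fun n => mul_nonneg (ha n).le (hnonneg _)) 0
    (by simpa using mul_pos (ha 0) hux)
  exact this.ne' hzero

/-- The dyadic multiples of `ℓ` are dense. -/
lemma exists_two_pow_mul_eq_int_mul_of_mem_nhds {ℓ : ℝ} (hℓ : 0 < ℓ) {x : ℝ} {s : Set ℝ}
    (hs : s ∈ nhds x) : ∃ y ∈ s, ∃ k : ℕ, ∃ m : ℤ, (2 : ℝ) ^ k * y = m * ℓ := by
  obtain ⟨ε, hε, hball⟩ := Metric.mem_nhds_iff.1 hs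
  obtain ⟨k, hk⟩ := exists_pow_lt_of_lt_one (div_pos hε hℓ) (by norm_num : (1 / 2 : ℝ) < 1)
  have h2 : (0 : ℝ) < 2 ^ k := by positivity
  have hk' : ℓ < ε * 2 ^ k := by
    rw [one_div, inv_pow, lt_div_iff₀ hℓ, inv_mul_lt_iff₀ h2] at hk
    linarith
  set m := ⌊x * 2 ^ k / ℓ⌋ with hm
  have hle : m * ℓ ≤ x * 2 ^ k := (le_div_iff₀ hℓ).1 (Int.floor_le _)
  have hlt : x * 2 ^ k < (m + 1) * ℓ := (div_lt_iff₀ hℓ).1 (Int.lt_floor_add_one _)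
  refine ⟨m * ℓ / 2 ^ k, hball ?_, k, m, by field_simp⟩
  rw [Metric.mem_ball, Real.dist_eq, abs_lt]
  constructor
  · rw [lt_sub_iff_add_lt, lt_div_iff₀ h2]
    linarith
  · rw [sub_lt_iff_lt_add, div_lt_iff₀ h2]
    nlinarith

/-- Let `u : ℝ → ℝ` be smooth, periodic with period `ℓ > 0`, positive off the lattice
`ℤℓ`, flat at `0` (all derivatives vanish), with all derivatives uniformly bounded, and
real-analytic at every point not of the form `mℓ`. Let `(a_n)` be strictly positive with
`∑ a_n x^n` convergent for every real `x`. Then `f(x) = ∑_{n=0}^∞ a_n u(2^n x)` is smooth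
and nowhere real-analytic. -/
theorem stmt18 (ℓ : ℝ) (hℓ : 0 < ℓ) (u : ℝ → ℝ) (hu : ContDiff ℝ (⊤ : ℕ∞) u)
    (hper : Function.Periodic u ℓ)
    (hpos : ∀ x : ℝ, (∀ m : ℤ, x ≠ (m : ℝ) * ℓ) → 0 < u x)
    (hflat : ∀ n : ℕ, iteratedDeriv n u 0 = 0)
    (M : ℕ → ℝ) (hM : ∀ (k : ℕ) (x : ℝ), |iteratedDeriv k u x| ≤ M k)
    (hanal : ∀ x : ℝ, (∀ m : ℤ, x ≠ (m : ℝ) * ℓ) → AnalyticAt ℝ u x)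
    (a : ℕ → ℝ) (ha : ∀ n, 0 < a n)
    (hconv : ∀ x : ℝ, Summable (fun n : ℕ => a n * x ^ n)) :
    ContDiff ℝ (⊤ : ℕ∞) (fun x : ℝ => ∑' n : ℕ, a n * u (2 ^ n * x)) ∧
    ∀ x : ℝ, ¬ AnalyticAt ℝ (fun x : ℝ => ∑' n : ℕ, a n * u (2 ^ n * x)) x := by
  refine ⟨contDiff_tsum_two_pow_mul hu hM ha hconv, fun x hx => ?_⟩
  obtain ⟨y, hy, hex⟩ := exists_two_pow_mul_eq_int_mul_of_mem_nhds hℓ hx.eventually_analyticAt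
  classical
  obtain ⟨m, hm⟩ := Nat.find_spec hex
  have hmin (n : ℕ) (hn : n < Nat.find hex) (j : ℤ) : (2 : ℝ) ^ n * y ≠ j * ℓ :=
    fun h => Nat.find_min hex hn ⟨j, h⟩
  generalize Nat.find hex = k at hm hmin
  have h2 : (2 : ℝ) ^ k ≠ 0 := by positivity
  have hconv' (z : ℝ) : Summable (fun n : ℕ => a (n + k) * z ^ n) := by
    rcases eq_or_ne z 0 with rfl | hz
    · exact summable_of_ne_finset_zero (s := {0}) fun n hn => by
        simp [Finset.mem_singleton.not.1 hn]
    · refine (((summable_nat_add_iff k).2 (hconv z)).mul_right (z ^ k)⁻¹).congr fun n => ?_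
      field_simp
      ring
  refine not_analyticAt_tsum_two_pow_mul_zero hℓ hu hper hpos hflat hM
    (fun n => ha (n + k)) hconv' ?_
  have hphi : AnalyticAt ℝ (fun w : ℝ => (w + m * ℓ) / 2 ^ k) 0 := by fun_prop (disch := exact h2)
  have hphi0 : ((0 : ℝ) + m * ℓ) / 2 ^ k = y := by
    rw [zero_add, ← hm]
    field_simp
  have hdiff : AnalyticAt ℝ (fun z : ℝ => (∑' n : ℕ, a n * u (2 ^ n * z))
      - ∑ n ∈ Finset.range k, a n * u (2 ^ n * z)) y := by
    refine AnalyticAt.sub hy (Finset.analyticAt_fun_sum _ fun n hn => ?_)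
    exact analyticAt_const.mul ((hanal _ (hmin n (Finset.mem_range.1 hn))).fun_comp
      (analyticAt_const.mul analyticAt_id))
  convert! hdiff.comp_of_eq hphi hphi0 using 1
  ext w
  have hsum := summable_two_pow_mul (C := M 0) (fun x => by simpa using hM 0 x) ha
    (by simpa using hconv 1) ((w + m * ℓ) / 2 ^ k)
  rw [Function.comp_apply, ← hsum.sum_add_tsum_nat_add k, add_sub_cancel_left]
  refine tsum_congr fun n => ?_
  have harg : (2 : ℝ) ^ (n + k) * ((w + m * ℓ) / 2 ^ k)
      = 2 ^ n * w + ((2 ^ n * m : ℤ) : ℝ) * ℓ := by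
    push_cast
    field_simp
    ring
  rw [harg, (hper.int_mul (2 ^ n * m)) _]
end
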